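/- Assume ‖·‖ is an admissible norm on ℝ³ and let f : M → ℝ³ be a connected immersed surface with Birkhoff normal field η. The Minkowski normal curvature of M is constant — i.e. there is λ ∈ ℝ with k_{M,p}(X) = λ for every p ∈ M and every nonzero X ∈ T_pM — if and only if M is contained in a plane or in a Minkowski sphere {x ∈ ℝ³ : ‖x − c‖ = ρ}. The planar case occurs exactly when λ = 0, and in the spherical case the radius is ρ = 1/|λ|. -/

import Mathlib

/-!
Differential geometry of immersed surfaces in three-dimensional normed
(Minkowski) spaces, following Balestro–Martini–Teixeira.

`E3 = ℝ³` carries its standard Euclidean inner product and, in addition, a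
norm `N` which is strictly convex and smooth.  Surfaces are given in a local
parametrization `f : P2 → E3` (an immersion on an open set `U`), endowed with
a Birkhoff normal field `η`.
-/

noncomputable section

open scoped InnerProductSpace

abbrev E3 := EuclideanSpace ℝ (Fin 3)
abbrev P2 := EuclideanSpace ℝ (Fin 2)

/-- A smooth, strictly convex norm on `ℝ³` (a Minkowski norm). -/
structure MinkowskiNorm3 where
  N : E3 → ℝ
  nonneg : ∀ x, 0 ≤ N x
  eq_zero_iff : ∀ x, N x = 0 ↔ x = 0
  smul_eq : ∀ (c : ℝ) (x : E3), N (c • x) = |c| * N x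
  triangle : ∀ x y, N (x + y) ≤ N x + N y
  strict_triangle : ∀ x y : E3, LinearIndependent ℝ ![x, y] → N (x + y) < N x + N y
  smooth : ContDiffOn ℝ (⊤ : ℕ∞) N {x : E3 | x ≠ 0}

namespace MinkowskiNorm3

/-- Birkhoff orthogonality of a vector `v` to a set (e.g. a plane) `H`:
`‖v + w‖ ≥ ‖v‖` for all `w ∈ H`. -/
def BirkhoffOrth (m : MinkowskiNorm3) (v : E3) (H : Set E3) : Prop :=
  ∀ w ∈ H, m.N v ≤ m.N (v + w)

/-- The (outward) Euclidean Gauss map of the unit sphere `∂B` of the norm,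
expressed on ambient space as the normalized gradient of `N`.  Restricted to
`∂B` it is the map `u⁻¹ : ∂B → ∂B_e`, whose inverse is `u : ∂B_e → ∂B`. -/
def sphereGauss (m : MinkowskiNorm3) (v : E3) : E3 :=
  ‖gradient m.N v‖⁻¹ • gradient m.N v

/-- The differential `du⁻¹` at a point `v ∈ ∂B`, applied to a vector `w`
(its restriction to the tangent plane of `∂B` at `v` is the inverse of
`du_{u⁻¹(v)}`). -/
def duInv (m : MinkowskiNorm3) (v w : E3) : E3 :=
  fderiv ℝ m.sphereGauss v w

/-- Admissibility of the norm: the unit sphere `∂B` has positive Euclidean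
Gaussian curvature at every point; equivalently, the second fundamental form
of `∂B` with respect to the outward normal is positive definite, i.e.
`⟪du⁻¹ w, w⟫ > 0` for every nonzero vector `w` tangent to `∂B`. -/
def Admissible (m : MinkowskiNorm3) : Prop :=
  ∀ v : E3, m.N v = 1 → ∀ w : E3, w ≠ 0 → fderiv ℝ m.N v w = 0 →
    0 < ⟪m.duInv v w, w⟫_ℝ

end MinkowskiNorm3

/-- An immersed surface (in a local parametrization on an open set `U ⊆ ℝ²`)
in the Minkowski space `(ℝ³, m)`, endowed with a Birkhoff normal vector
field `η`: a smooth unit field with `η(p) ⊣_B T_pM` for all `p`. -/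
structure BSurface (m : MinkowskiNorm3) where
  U : Set P2
  isOpen : IsOpen U
  f : P2 → E3
  smooth_f : ContDiffOn ℝ (⊤ : ℕ∞) f U
  immersion : ∀ p ∈ U, Function.Injective (fderiv ℝ f p)
  η : P2 → E3
  smooth_η : ContDiffOn ℝ (⊤ : ℕ∞) η U
  unit_η : ∀ p ∈ U, m.N (η p) = 1
  birkhoff : ∀ p ∈ U, m.BirkhoffOrth (η p) (Set.range (fderiv ℝ f p))

namespace BSurface

variable {m : MinkowskiNorm3}

/-- The tangent plane `T_pM`, identified (via the push-forward `df_p`) with a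
linear plane in ambient `ℝ³`. -/
def tangent (S : BSurface m) (p : P2) : Set E3 := Set.range (fderiv ℝ S.f p)

/-- `h : P2 → P2 → ℝ` (in the parameter coordinates, i.e. `h v w` stands for
`h(df_p v, df_p w)`) is the affine fundamental form of the immersion at `p`,
determined by the Gauss formula `D_X Y = ∇_X Y + h(X,Y) η`: for coordinate
directions `v, w`, the second derivative `D_v D_w f` minus `h v w • η p` is
tangential. -/
def IsAffineFundForm (S : BSurface m) (p : P2) (h : P2 → P2 → ℝ) : Prop :=
  ∀ v w : P2,
    fderiv ℝ (fun q => fderiv ℝ S.f q w) p v - h v w • S.η p ∈ S.tangent p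

end BSurface

/-- The Minkowski normal curvature of the surface parametrized by `f` with
Birkhoff normal field `η`, at `p`, in the tangent direction `X = df_p v`:
`k_{M,p}(X) = ⟪du⁻¹_{η(p)} X, dη_p X⟫ / ⟪du⁻¹_{η(p)} X, X⟫`, using the natural
identification of the parallel planes `T_pM ≅ T_{η(p)}∂B ≅ T_{ξ(p)}∂B_e`. -/
def normalCurv (m : MinkowskiNorm3) (f η : P2 → E3) (p v : P2) : ℝ :=
  ⟪m.duInv (η p) (fderiv ℝ f p v), fderiv ℝ η p v⟫_ℝ /
    ⟪m.duInv (η p) (fderiv ℝ f p v), fderiv ℝ f p v⟫_ℝ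

namespace MinkowskiNorm3

variable (m : MinkowskiNorm3)

theorem contDiffAt {x : E3} (hx : x ≠ 0) : ContDiffAt ℝ (⊤ : ℕ∞) m.N x :=
  m.smooth.contDiffAt (isOpen_ne.mem_nhds hx)

theorem differentiableAt {x : E3} (hx : x ≠ 0) : DifferentiableAt ℝ m.N x :=
  (m.contDiffAt hx).differentiableAt (by simp)

theorem contDiffAt_fderiv {x : E3} (hx : x ≠ 0) :
    ContDiffAt ℝ (⊤ : ℕ∞) (fderiv ℝ m.N) x :=
  (m.contDiffAt hx).fderiv_right (by simp)

theorem differentiableAt_fderiv {x : E3} (hx : x ≠ 0) :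
    DifferentiableAt ℝ (fderiv ℝ m.N) x :=
  (m.contDiffAt_fderiv hx).differentiableAt (by simp)

theorem ne_zero_of_eq_one {x : E3} (hx : m.N x = 1) : x ≠ 0 := by
  rintro rfl
  simp [(m.eq_zero_iff 0).2 rfl] at hx

theorem neg_eq (x : E3) : m.N (-x) = m.N x := by
  simpa using m.smul_eq (-1) x

theorem hasDerivAt_line {x : E3} (hx : x ≠ 0) (y : E3) :
    HasDerivAt (fun t : ℝ => m.N (x + t • y)) (fderiv ℝ m.N x y) 0 := by
  have h1 : HasDerivAt (fun t : ℝ => x + t • y) y 0 := by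
    simpa using ((hasDerivAt_id (0 : ℝ)).smul_const y).const_add x
  have h2 : HasFDerivAt m.N (fderiv ℝ m.N x) (x + (0 : ℝ) • y) := by
    simpa using (m.differentiableAt hx).hasFDerivAt
  exact h2.comp_hasDerivAt 0 h1

/-- Euler's identity for the norm. -/
theorem fderiv_self {x : E3} (hx : x ≠ 0) : fderiv ℝ m.N x x = m.N x := by
  refine (m.hasDerivAt_line hx x).unique ?_
  have h : HasDerivAt (fun t : ℝ => (1 + t) * m.N x) (m.N x) 0 := by
    simpa using ((hasDerivAt_id (0 : ℝ)).const_add 1).mul_const (m.N x)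
  refine h.congr_of_eventuallyEq ?_
  filter_upwards [lt_mem_nhds (show (-1 : ℝ) < 0 by norm_num)] with t ht
  have : x + t • x = (1 + t) • x := by rw [add_smul, one_smul]
  rw [this, m.smul_eq, abs_of_pos (by linarith)]

theorem fderiv_ne_zero {x : E3} (hx : x ≠ 0) : fderiv ℝ m.N x ≠ 0 := by
  intro h
  have h1 := m.fderiv_self hx
  rw [h] at h1
  exact hx ((m.eq_zero_iff x).1 h1.symm)

theorem fderiv_le {x : E3} (hx : x ≠ 0) (y : E3) : fderiv ℝ m.N x y ≤ m.N y := by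
  refine le_of_tendsto (m.hasDerivAt_line hx y).tendsto_slope_zero_right ?_
  filter_upwards [self_mem_nhdsWithin] with t ht
  have ht : 0 < t := ht
  have h1 := m.triangle x (t • y)
  rw [m.smul_eq, abs_of_pos ht] at h1
  simp only [zero_add, zero_smul, add_zero, smul_eq_mul]
  rw [inv_mul_le_iff₀ ht]
  linarith

theorem abs_fderiv_le {x : E3} (hx : x ≠ 0) (y : E3) : |fderiv ℝ m.N x y| ≤ m.N y := by
  refine abs_le.2 ⟨?_, m.fderiv_le hx y⟩
  have := m.fderiv_le hx (-y)
  rw [map_neg, m.neg_eq] at this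
  linarith

theorem eq_of_fderiv_eq_one {x y : E3} (hx : m.N x = 1) (hy : m.N y = 1)
    (h : fderiv ℝ m.N x y = 1) : y = x := by
  have hx0 := m.ne_zero_of_eq_one hx
  have hd : ¬ LinearIndependent ℝ ![x, y] := by
    intro hli
    have h1 := m.strict_triangle x y hli
    have h2 := m.fderiv_le hx0 (x + y)
    rw [map_add, m.fderiv_self hx0] at h2
    linarith
  rw [LinearIndependent.pair_iff' hx0] at hd
  push Not at hd
  obtain ⟨a, rfl⟩ := hd
  rw [map_smul, m.fderiv_self hx0, hx, smul_eq_mul, mul_one] at h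
  rw [h, one_smul]

theorem eq_neg_of_fderiv_eq_neg_one {x y : E3} (hx : m.N x = 1) (hy : m.N y = 1)
    (h : fderiv ℝ m.N x y = -1) : y = -x := by
  rw [← m.eq_of_fderiv_eq_one hx ((m.neg_eq y).trans hy) (by rw [map_neg, h, neg_neg]), neg_neg]

/-- Two unit vectors at which the unit sphere has parallel tangent planes satisfy
`dN_x y = ±1`. -/
theorem fderiv_sq_eq_one {x y : E3} (hx : m.N x = 1) (hy : m.N y = 1)
    (h : ∀ w, fderiv ℝ m.N x w = 0 → fderiv ℝ m.N y w = 0) :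
    fderiv ℝ m.N x y ^ 2 = 1 := by
  have hx0 := m.ne_zero_of_eq_one hx
  have hy0 := m.ne_zero_of_eq_one hy
  have h1 := h (y - fderiv ℝ m.N x y • x) (by
    rw [map_sub, map_smul, m.fderiv_self hx0, hx]; simp)
  rw [map_sub, map_smul, m.fderiv_self hy0, hy, smul_eq_mul] at h1
  have h2 := m.abs_fderiv_le hx0 y
  have h3 := m.abs_fderiv_le hy0 x
  rw [hy] at h2
  rw [hx] at h3
  have h4 : |fderiv ℝ m.N x y| * |fderiv ℝ m.N y x| = 1 := by
    rw [← abs_mul, show fderiv ℝ m.N x y * fderiv ℝ m.N y x = 1 by linarith, abs_one]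
  have h5 : |fderiv ℝ m.N x y| = 1 := by
    nlinarith [abs_nonneg (fderiv ℝ m.N x y)]
  rw [← sq_abs, h5, one_pow]

/-- The Hessian of the norm. -/
def hess (x : E3) : E3 →L[ℝ] E3 →L[ℝ] ℝ := fderiv ℝ (fderiv ℝ m.N) x

theorem hess_symm {x : E3} (hx : x ≠ 0) (v w : E3) : m.hess x v w = m.hess x w v :=
  ((m.contDiffAt hx).isSymmSndFDerivAt
      (by simpa using WithTop.coe_le_coe.2 (le_top (a := (2 : ℕ∞))))) v w

theorem inner_gradient (x w : E3) : ⟪gradient m.N x, w⟫_ℝ = fderiv ℝ m.N x w := by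
  simp [gradient]

theorem gradient_ne_zero {x : E3} (hx : x ≠ 0) : gradient m.N x ≠ 0 := by
  intro h
  have h1 := m.inner_gradient x x
  rw [h, inner_zero_left, m.fderiv_self hx] at h1
  exact hx ((m.eq_zero_iff x).1 h1.symm)

theorem inner_duInv {x : E3} (hx : x ≠ 0) (w : E3) {y : E3} (hy : fderiv ℝ m.N x y = 0) :
    ⟪m.duInv x w, y⟫_ℝ = ‖gradient m.N x‖⁻¹ * m.hess x w y := by
  let D : (E3 →L[ℝ] ℝ) →ₗ[ℝ] E3 :=
    { toFun := (InnerProductSpace.toDual ℝ E3).symm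
      map_add' := map_add _
      map_smul' := fun c L => by simp }
  have hD : ∀ L z, ⟪D L, z⟫_ℝ = L z := fun L z => InnerProductSpace.toDual_symm_apply
  have hg : HasFDerivAt (gradient m.N) (D.toContinuousLinearMap.comp (m.hess x)) x :=
    D.toContinuousLinearMap.hasFDerivAt.comp x (m.differentiableAt_fderiv hx).hasFDerivAt
  have h0 := m.gradient_ne_zero hx
  have hr : DifferentiableAt ℝ (fun z => ‖gradient m.N z‖⁻¹) x :=
    (hg.differentiableAt.norm ℝ h0).inv (norm_ne_zero_iff.2 h0)
  have hs : HasFDerivAt m.sphereGauss _ x := hr.hasFDerivAt.smul hg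
  rw [duInv, hs.fderiv]
  simp [inner_add_left, real_inner_smul_left, m.inner_gradient, hy, hD]

theorem duInv_pos_iff {x : E3} (hx : x ≠ 0) {w : E3} (hw : fderiv ℝ m.N x w = 0) :
    0 < ⟪m.duInv x w, w⟫_ℝ ↔ 0 < m.hess x w w := by
  rw [m.inner_duInv hx w hw,
    mul_pos_iff_of_pos_left (inv_pos.2 (norm_pos_iff.2 (m.gradient_ne_zero hx)))]

end MinkowskiNorm3

theorem exists_eq_of_injective_of_apply_eq_zero (A : P2 →L[ℝ] E3) (hA : Function.Injective A)
    (L : E3 →L[ℝ] ℝ) (hL : L ≠ 0) (h : ∀ v, L (A v) = 0) {w : E3} (hw : L w = 0) :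
    ∃ v, A v = w := by
  have hle : LinearMap.range (A : P2 →ₗ[ℝ] E3) ≤ LinearMap.ker (L : E3 →ₗ[ℝ] ℝ) := by
    rintro _ ⟨v, rfl⟩
    exact h v
  have h1 : Module.finrank ℝ (LinearMap.range (A : P2 →ₗ[ℝ] E3)) = 2 := by
    rw [LinearMap.finrank_range_of_inj hA]; simp
  have hL' : (L : E3 →ₗ[ℝ] ℝ) ≠ 0 := fun hz => hL (by ext z; exact LinearMap.congr_fun hz z)
  have h2 : Module.finrank ℝ (LinearMap.range (L : E3 →ₗ[ℝ] ℝ)) = 1 := by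
    rw [LinearMap.range_eq_top.2 (LinearMap.surjective hL')]; simp
  have h3 := LinearMap.finrank_range_add_finrank_ker (L : E3 →ₗ[ℝ] ℝ)
  have h4 : Module.finrank ℝ E3 = 3 := by simp
  have heq := Submodule.eq_of_le_of_finrank_eq hle (by omega)
  have hmem : w ∈ LinearMap.range (A : P2 →ₗ[ℝ] E3) := by rw [heq]; exact hw
  exact hmem

namespace BSurface

variable {m : MinkowskiNorm3} (S : BSurface m) {p : P2}

theorem eta_ne_zero (hp : p ∈ S.U) : S.η p ≠ 0 := m.ne_zero_of_eq_one (S.unit_η p hp)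

theorem contDiffAt_f (hp : p ∈ S.U) : ContDiffAt ℝ (⊤ : ℕ∞) S.f p :=
  S.smooth_f.contDiffAt (S.isOpen.mem_nhds hp)

theorem differentiableAt_f (hp : p ∈ S.U) : DifferentiableAt ℝ S.f p :=
  (S.contDiffAt_f hp).differentiableAt (by simp)

theorem differentiableAt_eta (hp : p ∈ S.U) : DifferentiableAt ℝ S.η p :=
  (S.smooth_η.contDiffAt (S.isOpen.mem_nhds hp)).differentiableAt (by simp)

theorem fderiv_norm_eta_tangent (hp : p ∈ S.U) (v : P2) :
    fderiv ℝ m.N (S.η p) (fderiv ℝ S.f p v) = 0 := by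
  refine IsLocalMin.hasDerivAt_eq_zero (Filter.Eventually.of_forall fun t => ?_)
    (m.hasDerivAt_line (S.eta_ne_zero hp) (fderiv ℝ S.f p v))
  have := S.birkhoff p hp (t • fderiv ℝ S.f p v) ⟨t • v, by rw [map_smul]⟩
  simpa using this

theorem fderiv_norm_eta_fderiv_eta (hp : p ∈ S.U) (v : P2) :
    fderiv ℝ m.N (S.η p) (fderiv ℝ S.η p v) = 0 := by
  have h1 : HasFDerivAt (fun q => m.N (S.η q)) _ p :=
    (m.differentiableAt (S.eta_ne_zero hp)).hasFDerivAt.comp p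
      (S.differentiableAt_eta hp).hasFDerivAt
  have h2 : HasFDerivAt (fun q => m.N (S.η q)) (0 : P2 →L[ℝ] ℝ) p := by
    refine (hasFDerivAt_const (1 : ℝ) p).congr_of_eventuallyEq ?_
    filter_upwards [S.isOpen.mem_nhds hp] with q hq using S.unit_η q hq
  exact DFunLike.congr_fun (h1.unique h2) v

theorem exists_fderiv_eq (hp : p ∈ S.U) {L : E3 →L[ℝ] ℝ} (hL : L ≠ 0)
    (h : ∀ v, L (fderiv ℝ S.f p v) = 0) {w : E3} (hw : L w = 0) :
    ∃ v, fderiv ℝ S.f p v = w :=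
  exists_eq_of_injective_of_apply_eq_zero _ (S.immersion p hp) L hL h hw

theorem exists_fderiv_eq_of_fderiv_norm_eq_zero (hp : p ∈ S.U) {w : E3}
    (hw : fderiv ℝ m.N (S.η p) w = 0) : ∃ v, fderiv ℝ S.f p v = w :=
  S.exists_fderiv_eq hp (m.fderiv_ne_zero (S.eta_ne_zero hp))
    (S.fderiv_norm_eta_tangent hp) hw

/-- Differentiating `dN_η (df v) = 0` along the surface. -/
theorem hess_fderiv_eta (hp : p ∈ S.U) (v w : P2) :
    m.hess (S.η p) (fderiv ℝ S.η p w) (fderiv ℝ S.f p v) =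
      -fderiv ℝ m.N (S.η p) (fderiv ℝ (fderiv ℝ S.f) p w v) := by
  have hN : HasFDerivAt (fun q => fderiv ℝ m.N (S.η q)) _ p :=
    (m.differentiableAt_fderiv (S.eta_ne_zero hp)).hasFDerivAt.comp p
      (S.differentiableAt_eta hp).hasFDerivAt
  have hf : HasFDerivAt (fderiv ℝ S.f) _ p :=
    (((S.contDiffAt_f hp).fderiv_right (m := (⊤ : ℕ∞)) (by simp)).differentiableAt
      (by simp)).hasFDerivAt
  have hfv := hf.clm_apply (hasFDerivAt_const v p)
  have h1 := hN.clm_apply hfv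
  have h2 : HasFDerivAt (fun q => fderiv ℝ m.N (S.η q) (fderiv ℝ S.f q v))
      (0 : P2 →L[ℝ] ℝ) p := by
    refine (hasFDerivAt_const (0 : ℝ) p).congr_of_eventuallyEq ?_
    filter_upwards [S.isOpen.mem_nhds hp] with q hq using S.fderiv_norm_eta_tangent hq v
  have h3 := DFunLike.congr_fun (h1.unique h2) w
  simp at h3
  rw [MinkowskiNorm3.hess]
  linarith

theorem hess_fderiv_eta_symm (hp : p ∈ S.U) (v w : P2) :
    m.hess (S.η p) (fderiv ℝ S.η p w) (fderiv ℝ S.f p v) =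
      m.hess (S.η p) (fderiv ℝ S.η p v) (fderiv ℝ S.f p w) := by
  rw [S.hess_fderiv_eta hp, S.hess_fderiv_eta hp,
    ((S.contDiffAt_f hp).isSymmSndFDerivAt
      (by simpa using WithTop.coe_le_coe.2 (le_top (a := (2 : ℕ∞))))) v w]

theorem fderiv_f_ne_zero (hp : p ∈ S.U) {v : P2} (hv : v ≠ 0) : fderiv ℝ S.f p v ≠ 0 :=
  fun h => hv (S.immersion p hp (by rw [h, map_zero]))

theorem normalCurv_eq_of_fderiv_eta (hadm : m.Admissible) (hp : p ∈ S.U) {v : P2} (hv : v ≠ 0)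
    {lam : ℝ} (h : fderiv ℝ S.η p v = lam • fderiv ℝ S.f p v) :
    normalCurv m S.f S.η p v = lam := by
  have hpos := hadm (S.η p) (S.unit_η p hp) _ (S.fderiv_f_ne_zero hp hv)
    (S.fderiv_norm_eta_tangent hp v)
  rw [normalCurv, h, real_inner_smul_right, mul_div_cancel_right₀ _ hpos.ne']

theorem hess_pos (hadm : m.Admissible) (hp : p ∈ S.U) {w : E3} (hw : w ≠ 0)
    (hw' : fderiv ℝ m.N (S.η p) w = 0) : 0 < m.hess (S.η p) w w :=
  (m.duInv_pos_iff (S.eta_ne_zero hp) hw').1 (hadm _ (S.unit_η p hp) w hw hw')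

/-- A point at which the normal curvature does not depend on the direction is umbilical. -/
theorem fderiv_eta_eq_of_normalCurv (hadm : m.Admissible) (hp : p ∈ S.U) {lam : ℝ}
    (h : ∀ v : P2, v ≠ 0 → normalCurv m S.f S.η p v = lam) :
    fderiv ℝ S.η p = lam • fderiv ℝ S.f p := by
  have h0 := S.eta_ne_zero hp
  set df := fderiv ℝ S.f p with hdf
  set A := fderiv ℝ S.η p - lam • df with hA
  have hT : ∀ v, fderiv ℝ m.N (S.η p) (df v) = 0 := S.fderiv_norm_eta_tangent hp
  have hAT : ∀ v, fderiv ℝ m.N (S.η p) (A v) = 0 := fun v => by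
    simp [hA, S.fderiv_norm_eta_fderiv_eta hp v, hT v]
  have hdiag : ∀ v, m.hess (S.η p) (A v) (df v) = 0 := by
    intro v
    rcases eq_or_ne v 0 with rfl | hv
    · simp
    have hpos := hadm (S.η p) (S.unit_η p hp) _ (S.fderiv_f_ne_zero hp hv) (hT v)
    have h1 := h v hv
    rw [normalCurv, div_eq_iff hpos.ne', m.inner_duInv h0 _ (hT v),
      m.inner_duInv h0 _ (S.fderiv_norm_eta_fderiv_eta hp v), mul_left_comm] at h1
    have h2 := mul_left_cancel₀
      (inv_ne_zero (norm_ne_zero_iff.2 (m.gradient_ne_zero h0))) h1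
    rw [m.hess_symm h0]
    simp only [hA, sub_apply, smul_apply, map_sub, map_smul, smul_eq_mul]
    rw [hdf, h2, sub_self]
  have hsymm : ∀ v w, m.hess (S.η p) (A v) (df w) = m.hess (S.η p) (A w) (df v) := by
    intro v w
    have h1 := S.hess_fderiv_eta_symm hp v w
    have h2 := m.hess_symm h0 (df v) (df w)
    simp only [hA, sub_apply, smul_apply, map_sub,
      map_smul, smul_eq_mul]
    rw [h2, h1]
  have hall : ∀ v w, m.hess (S.η p) (A v) (df w) = 0 := by
    intro v w
    have h1 := hdiag (v + w)
    simp only [map_add, add_apply] at h1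
    linarith [hdiag v, hdiag w, hsymm v w]
  ext1 v
  by_contra hne
  have hAv : A v ≠ 0 := by
    simpa [hA, sub_eq_zero] using hne
  obtain ⟨w, hw⟩ := S.exists_fderiv_eq_of_fderiv_norm_eq_zero hp (hAT v)
  have h1 := S.hess_pos hadm hp hAv (hAT v)
  have h2 := hall v w
  rw [hdf, hw] at h2
  linarith

theorem exists_eta_eq_of_normalCurv (hadm : m.Admissible) (hconn : IsPreconnected S.U)
    {lam : ℝ} (h : ∀ p ∈ S.U, ∀ v : P2, v ≠ 0 → normalCurv m S.f S.η p v = lam) :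
    ∃ c : E3, ∀ q ∈ S.U, S.η q = lam • S.f q + c := by
  have hd : ∀ q ∈ S.U, HasFDerivAt (fun q => S.η q - lam • S.f q) (0 : P2 →L[ℝ] E3) q := by
    intro q hq
    have h1 := (S.differentiableAt_eta hq).hasFDerivAt.sub
      ((S.differentiableAt_f hq).hasFDerivAt.const_smul lam)
    rwa [S.fderiv_eta_eq_of_normalCurv hadm hq (h q hq), sub_self] at h1
  obtain ⟨c, hc⟩ := S.isOpen.exists_is_const_of_fderiv_eq_zero hconn
    (fun q hq => (hd q hq).differentiableAt.differentiableWithinAt)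
    (fun q hq => (hd q hq).fderiv)
  exact ⟨c, fun q hq => by rw [← hc q hq]; abel⟩

theorem subset_plane_of_eta_const (hconn : IsConnected S.U) {c : E3}
    (h : ∀ q ∈ S.U, S.η q = c) :
    ∃ a : E3, a ≠ 0 ∧ ∃ b : ℝ, ∀ q ∈ S.U, ⟪a, S.f q⟫_ℝ = b := by
  obtain ⟨p, hp⟩ := hconn.nonempty
  have hc0 : c ≠ 0 := h p hp ▸ S.eta_ne_zero hp
  refine ⟨gradient m.N c, m.gradient_ne_zero hc0, ?_⟩
  simp only [m.inner_gradient]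
  have hd : ∀ q ∈ S.U, HasFDerivAt (fun q => fderiv ℝ m.N c (S.f q)) (0 : P2 →L[ℝ] ℝ) q := by
    intro q hq
    have h1 := (fderiv ℝ m.N c).hasFDerivAt.comp q (S.differentiableAt_f hq).hasFDerivAt
    have h2 : (fderiv ℝ m.N c).comp (fderiv ℝ S.f q) = 0 := by
      ext1 v
      simpa [h q hq] using S.fderiv_norm_eta_tangent hq v
    rwa [h2] at h1
  exact S.isOpen.exists_is_const_of_fderiv_eq_zero hconn.isPreconnected
    (fun q hq => (hd q hq).differentiableAt.differentiableWithinAt)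
    (fun q hq => (hd q hq).fderiv)

theorem norm_sub_eq_of_eta_eq {lam : ℝ} (hlam : lam ≠ 0) {c : E3}
    (h : ∀ q ∈ S.U, S.η q = lam • S.f q + c) :
    ∀ q ∈ S.U, m.N (S.f q - -(lam⁻¹ • c)) = |lam|⁻¹ := by
  intro q hq
  have h1 : S.f q - -(lam⁻¹ • c) = lam⁻¹ • S.η q := by
    rw [h q hq, smul_add, smul_smul, inv_mul_cancel₀ hlam, one_smul, sub_neg_eq_add]
  rw [h1, m.smul_eq, S.unit_η q hq, mul_one, abs_inv]

theorem fderiv_eta_eq_zero_of_subset_plane (hadm : m.Admissible) {a : E3} (ha : a ≠ 0) {c : ℝ}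
    (h : ∀ q ∈ S.U, ⟪a, S.f q⟫_ℝ = c) (hp : p ∈ S.U) (v : P2) : fderiv ℝ S.η p v = 0 := by
  have hL : innerSL ℝ a ≠ 0 := fun h0 => ha (inner_self_eq_zero.1 (DFunLike.congr_fun h0 a))
  have hLf : ∀ q ∈ S.U, ∀ v, innerSL ℝ a (fderiv ℝ S.f q v) = 0 := by
    intro q hq v
    have h1 := (innerSL ℝ a).hasFDerivAt.comp q (S.differentiableAt_f hq).hasFDerivAt
    have h2 : HasFDerivAt (innerSL ℝ a ∘ S.f) (0 : P2 →L[ℝ] ℝ) q := by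
      refine (hasFDerivAt_const c q).congr_of_eventuallyEq ?_
      filter_upwards [S.isOpen.mem_nhds hq] with r hr using h r hr
    exact DFunLike.congr_fun (h1.unique h2) v
  have hT : ∀ q ∈ S.U, ∀ w, innerSL ℝ a w = 0 → fderiv ℝ m.N (S.η q) w = 0 := by
    intro q hq w hw
    obtain ⟨v, rfl⟩ := S.exists_fderiv_eq hq hL (hLf q hq) hw
    exact S.fderiv_norm_eta_tangent hq v
  by_contra hne
  have hv := S.fderiv_norm_eta_fderiv_eta hp v
  obtain ⟨u, hu⟩ := S.exists_fderiv_eq_of_fderiv_norm_eq_zero hp hv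
  have hav : innerSL ℝ a (fderiv ℝ S.η p v) = 0 := hu ▸ hLf p hp u
  have hN : HasFDerivAt (fun q => fderiv ℝ m.N (S.η q)) _ p :=
    (m.differentiableAt_fderiv (S.eta_ne_zero hp)).hasFDerivAt.comp p
      (S.differentiableAt_eta hp).hasFDerivAt
  have h1 := hN.clm_apply (hasFDerivAt_const (fderiv ℝ S.η p v) p)
  have h2 : HasFDerivAt (fun q => fderiv ℝ m.N (S.η q) (fderiv ℝ S.η p v))
      (0 : P2 →L[ℝ] ℝ) p := by
    refine (hasFDerivAt_const (0 : ℝ) p).congr_of_eventuallyEq ?_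
    filter_upwards [S.isOpen.mem_nhds hp] with q hq using hT q hq _ hav
  have h3 := DFunLike.congr_fun (h1.unique h2) v
  have h4 := S.hess_pos hadm hp hne hv
  simp at h3
  rw [MinkowskiNorm3.hess] at h4
  linarith

theorem normalCurv_eq_zero_of_subset_plane (hadm : m.Admissible) {a : E3} (ha : a ≠ 0) {c : ℝ}
    (h : ∀ q ∈ S.U, ⟪a, S.f q⟫_ℝ = c) (hp : p ∈ S.U) {v : P2} (hv : v ≠ 0) :
    normalCurv m S.f S.η p v = 0 :=
  S.normalCurv_eq_of_fderiv_eta hadm hp hv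
    (by rw [S.fderiv_eta_eq_zero_of_subset_plane hadm ha h hp, zero_smul])

/-- On a connected surface contained in a Minkowski sphere, the Birkhoff normal is plus or minus
the normalized position vector. -/
theorem eta_eq_of_subset_sphere (hconn : IsPreconnected S.U) {c : E3} {ρ : ℝ} (hρ : 0 < ρ)
    (h : ∀ q ∈ S.U, m.N (S.f q - c) = ρ) :
    ∃ lam : ℝ, ∀ q ∈ S.U, S.η q = lam • (S.f q - c) := by
  have hx1 : ∀ q ∈ S.U, m.N (ρ⁻¹ • (S.f q - c)) = 1 := by
    intro q hq
    rw [m.smul_eq, h q hq, abs_of_pos (inv_pos.2 hρ), inv_mul_cancel₀ hρ.ne']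
  have hx0 : ∀ q ∈ S.U, ρ⁻¹ • (S.f q - c) ≠ 0 := fun q hq => m.ne_zero_of_eq_one (hx1 q hq)
  have hT : ∀ q ∈ S.U, ∀ v,
      fderiv ℝ m.N (ρ⁻¹ • (S.f q - c)) (fderiv ℝ S.f q v) = 0 := by
    intro q hq v
    have h1 : HasFDerivAt (fun r => m.N (ρ⁻¹ • (S.f r - c))) _ q :=
      (m.differentiableAt (hx0 q hq)).hasFDerivAt.comp q
        (((S.differentiableAt_f hq).hasFDerivAt.sub_const c).const_smul ρ⁻¹)
    have h2 : HasFDerivAt (fun r => m.N (ρ⁻¹ • (S.f r - c))) (0 : P2 →L[ℝ] ℝ) q := by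
      refine (hasFDerivAt_const (1 : ℝ) q).congr_of_eventuallyEq ?_
      filter_upwards [S.isOpen.mem_nhds hq] with r hr using hx1 r hr
    have h3 := DFunLike.congr_fun (h1.unique h2) v
    simpa [hρ.ne'] using h3
  have hsq : ∀ q ∈ S.U, fderiv ℝ m.N (ρ⁻¹ • (S.f q - c)) (S.η q) ^ 2 = 1 := by
    intro q hq
    refine m.fderiv_sq_eq_one (hx1 q hq) (S.unit_η q hq) fun w hw => ?_
    obtain ⟨v, rfl⟩ := S.exists_fderiv_eq hq (m.fderiv_ne_zero (hx0 q hq)) (hT q hq) hw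
    exact S.fderiv_norm_eta_tangent hq v
  have hcont : ContinuousOn (fun q => fderiv ℝ m.N (ρ⁻¹ • (S.f q - c)) (S.η q)) S.U := by
    intro q hq
    have h1 : ContinuousAt (fun r => ρ⁻¹ • (S.f r - c)) q :=
      ((S.differentiableAt_f hq).continuousAt.sub continuousAt_const).const_smul ρ⁻¹
    have h2 : ContinuousAt (fun r => fderiv ℝ m.N (ρ⁻¹ • (S.f r - c))) q :=
      ContinuousAt.comp (f := fun r => ρ⁻¹ • (S.f r - c))
        (m.contDiffAt_fderiv (hx0 q hq)).continuousAt h1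
    exact (h2.clm_apply (S.differentiableAt_eta hq).continuousAt).continuousWithinAt
  rcases hconn.eq_one_or_eq_neg_one_of_sq_eq hcont (fun q hq => hsq q hq) with h1 | h1
  · exact ⟨ρ⁻¹, fun q hq => m.eq_of_fderiv_eq_one (hx1 q hq) (S.unit_η q hq) (h1 hq)⟩
  · refine ⟨-ρ⁻¹, fun q hq => ?_⟩
    rw [neg_smul]
    exact m.eq_neg_of_fderiv_eq_neg_one (hx1 q hq) (S.unit_η q hq) (h1 hq)

theorem exists_normalCurv_eq_of_subset_sphere (hadm : m.Admissible) (hconn : IsPreconnected S.U)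
    {c : E3} {ρ : ℝ} (hρ : 0 < ρ) (h : ∀ q ∈ S.U, m.N (S.f q - c) = ρ) :
    ∃ lam : ℝ, ∀ p ∈ S.U, ∀ v : P2, v ≠ 0 → normalCurv m S.f S.η p v = lam := by
  obtain ⟨lam, hlam⟩ := S.eta_eq_of_subset_sphere hconn hρ h
  refine ⟨lam, fun p hp v hv => S.normalCurv_eq_of_fderiv_eta hadm hp hv ?_⟩
  have h1 : HasFDerivAt S.η (lam • fderiv ℝ S.f p) p := by
    refine (((S.differentiableAt_f hp).hasFDerivAt.sub_const c).const_smul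
      lam).congr_of_eventuallyEq ?_
    filter_upwards [S.isOpen.mem_nhds hp] with q hq using hlam q hq
  rw [h1.fderiv, smul_apply]

end BSurface

/-- For an admissible norm, the Minkowski normal curvature of
a connected immersed surface is constant (equal to some `λ` at every point and
in every direction) if and only if the surface is contained in a plane or in a
Minkowski sphere; the planar case occurs exactly when `λ = 0`, and in the
spherical case the radius is `1/|λ|`. -/
theorem constant_normal_curvature (m : MinkowskiNorm3) (hadm : m.Admissible)
    (S : BSurface m) (hconn : IsConnected S.U) :
    ((∃ lam : ℝ, ∀ p ∈ S.U, ∀ v : P2, v ≠ 0 → normalCurv m S.f S.η p v = lam) ↔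
      ((∃ a : E3, a ≠ 0 ∧ ∃ c : ℝ, ∀ q ∈ S.U, ⟪a, S.f q⟫_ℝ = c) ∨
       (∃ cc : E3, ∃ ρ : ℝ, 0 < ρ ∧ ∀ q ∈ S.U, m.N (S.f q - cc) = ρ))) ∧
    (∀ lam : ℝ, (∀ p ∈ S.U, ∀ v : P2, v ≠ 0 → normalCurv m S.f S.η p v = lam) →
      ((lam = 0 ↔ ∃ a : E3, a ≠ 0 ∧ ∃ c : ℝ, ∀ q ∈ S.U, ⟪a, S.f q⟫_ℝ = c) ∧
       (lam ≠ 0 → ∃ cc : E3, ∀ q ∈ S.U, m.N (S.f q - cc) = |lam|⁻¹))) := by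
  have hflat : (∀ p ∈ S.U, ∀ v : P2, v ≠ 0 → normalCurv m S.f S.η p v = 0) →
      ∃ a : E3, a ≠ 0 ∧ ∃ c : ℝ, ∀ q ∈ S.U, ⟪a, S.f q⟫_ℝ = c := by
    intro h
    obtain ⟨c, hc⟩ := S.exists_eta_eq_of_normalCurv hadm hconn.isPreconnected h
    exact S.subset_plane_of_eta_const hconn (c := c) fun q hq => by simpa using hc q hq
  have hround : ∀ lam : ℝ, lam ≠ 0 →
      (∀ p ∈ S.U, ∀ v : P2, v ≠ 0 → normalCurv m S.f S.η p v = lam) →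
      ∃ cc : E3, ∀ q ∈ S.U, m.N (S.f q - cc) = |lam|⁻¹ := by
    intro lam hlam h
    obtain ⟨c, hc⟩ := S.exists_eta_eq_of_normalCurv hadm hconn.isPreconnected h
    exact ⟨_, S.norm_sub_eq_of_eta_eq hlam hc⟩
  refine ⟨⟨?_, ?_⟩, fun lam h => ⟨⟨?_, ?_⟩, fun hlam => hround lam hlam h⟩⟩
  · rintro ⟨lam, h⟩
    rcases eq_or_ne lam 0 with rfl | hlam
    · exact Or.inl (hflat h)
    · obtain ⟨cc, hcc⟩ := hround lam hlam h
      exact Or.inr ⟨cc, |lam|⁻¹, inv_pos.2 (abs_pos.2 hlam), hcc⟩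
  · rintro (⟨a, ha, c, h⟩ | ⟨cc, ρ, hρ, h⟩)
    · exact ⟨0, fun p hp v hv => S.normalCurv_eq_zero_of_subset_plane hadm ha h hp hv⟩
    · exact S.exists_normalCurv_eq_of_subset_sphere hadm hconn.isPreconnected hρ h
  · rintro rfl
    exact hflat h
  · rintro ⟨a, ha, c, hc⟩
    obtain ⟨p, hp⟩ := hconn.nonempty
    obtain ⟨v, hv⟩ := exists_ne (0 : P2)
    rw [← h p hp v hv, S.normalCurv_eq_zero_of_subset_plane hadm ha hc hp hv]
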